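/- arXiv:2511.07417 — 5 statements merged into one kernel-verified Lean document; each statement's English description precedes it below -/
import Mathlib

section
/- For every countable collection of languages 𝓛 : ℕ → Set ℕ (each 𝓛 i infinite), every ε ∈ (0,1), and every real M ≥ 1, there exists an element-based generator G : List ℕ → ℕ such that for every index i* and every injective sequence x : ℕ → ℕ that is an M-bounded displacement enumeration with respect to K := 𝓛 i*, with {n : x_n ∈ K} infinite and R(K; x_{1:n}) → 0 as n → ∞: G generates in the limit from K under x, and the output set W := {G(x_1,…,x_n) : n ∈ ℕ} satisfies μ_low(W, K) ≥ (1 − ε)/(2M). -/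
open Filter Set Topology

/-- The list `[x 0, …, x (n-1)]` of the first `n` elements of the stream `x`
(the paper's `x_1, …, x_n`). -/
def prefixList (x : ℕ → ℕ) (n : ℕ) : List ℕ := (List.range n).map x

/-- The set of the first `n` elements of the stream `x` (the paper's `{x_1, …, x_n}`). -/
def seen (x : ℕ → ℕ) (n : ℕ) : Set ℕ := x '' {t | t < n}

/-- The empirical noise rate `R(L; x_{1:n})` of the first `n` elements of `x` w.r.t. `L`. -/
noncomputable def noiseRate (L : Set ℕ) (x : ℕ → ℕ) (n : ℕ) : ℝ :=
  (({t | t < n ∧ x t ∉ L}).ncard : ℝ) / n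

/-- `|A ∩ {b_1, …, b_m}| / m` where `b_1 < b_2 < …` is the increasing enumeration of `B`. -/
noncomputable def densityRatio (A B : Set ℕ) (m : ℕ) : ℝ :=
  (({j | j < m ∧ Nat.nth (· ∈ B) j ∈ A}).ncard : ℝ) / m

/-- Lower density `μ_low(A, B)` of `A` in `B`. -/
noncomputable def lowDensity (A B : Set ℕ) : ℝ := Filter.liminf (densityRatio A B) Filter.atTop

/-- Upper density `μ_up(A, B)` of `A` in `B`. -/
noncomputable def upDensity (A B : Set ℕ) : ℝ := Filter.limsup (densityRatio A B) Filter.atTop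
open Classical in
/-- The 1-indexed position `σ(y, L)` of `y` in the increasing enumeration of `L`
(and `0` if `y ∉ L`). -/
noncomputable def position (y : ℕ) (L : Set ℕ) : ℕ :=
  if y ∈ L then {z | z ∈ L ∧ z ≤ y}.ncard else 0

/-- `x` is an `M`-bounded displacement enumeration w.r.t. `L`:
`σ(x_n, L) ≤ M · n` for all sufficiently large `n` (here `x t` is the `(t+1)`-st element). -/
def MBounded (x : ℕ → ℕ) (L : Set ℕ) (M : ℝ) : Prop :=
  ∃ nstar : ℕ, ∀ n ≥ nstar, (position (x n) L : ℝ) ≤ M * (n + 1)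

/-- The first `m` elements of `L` in increasing order. -/
noncomputable def firstElems (L : Set ℕ) (m : ℕ) : Finset ℕ :=
  (Finset.range m).image (Nat.nth (· ∈ L))

/-- The intersection of the languages with index in `F`. -/
def commonPart (𝓛 : ℕ → Set ℕ) (F : Finset ℕ) : Set ℕ := {y | ∀ j ∈ F, y ∈ 𝓛 j}

/-- Step `s` is evidence against `L`: the displacement bound `M` fails at `x s`, or the noise rate
exceeds `δ`. -/
def Violation (L : Set ℕ) (δ M : ℝ) (x : ℕ → ℕ) (s : ℕ) : Prop :=
  M * (s + 1) < position (x s) L ∨ δ < noiseRate L x (s + 1)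

/-- The noise tolerance granted to the language of index `j`. -/
noncomputable def tolerance (ε : ℝ) (j : ℕ) : ℝ := ε / 2 * (1 / 2) ^ (j + 1)

open Classical in
/-- The index `j` plus the number of violations of `𝓛 j` before time `n`. -/
noncomputable def penalty (𝓛 : ℕ → Set ℕ) (ε M : ℝ) (x : ℕ → ℕ) (n j : ℕ) : ℕ :=
  j + Nat.count (Violation (𝓛 j) (tolerance ε j) M x) n

open Classical in
/-- The indices whose penalty at time `n` is at most `v`. -/
noncomputable def candidates (𝓛 : ℕ → Set ℕ) (ε M : ℝ) (x : ℕ → ℕ) (n v : ℕ) : Finset ℕ :=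
  (Finset.range (v + 1)).filter fun j => penalty 𝓛 ε M x n j ≤ v

open Classical in
/-- From rank `n` on, the common part of `F` has density at least `θ` in every member of `F`. -/
def DenseFrom (𝓛 : ℕ → Set ℕ) (θ : ℝ) (n : ℕ) (F : Finset ℕ) : Prop :=
  ∀ i ∈ F, ∀ m ≥ n, θ * m ≤ (((firstElems (𝓛 i) m).filter (· ∈ commonPart 𝓛 F)).card : ℝ)

open Classical in
/-- The common part of the largest set of candidates that is dense from rank `n` on. -/
noncomputable def target (𝓛 : ℕ → Set ℕ) (ε M : ℝ) (x : ℕ → ℕ) (n : ℕ) : Set ℕ :=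
  commonPart 𝓛 (candidates 𝓛 ε M x n
    (Nat.findGreatest (fun v => DenseFrom 𝓛 ((1 - ε) / M) n (candidates 𝓛 ε M x n v)) n))

/-- The outputs produced before time `n` when each output is the least element of the current
target `I t` that is neither seen nor already produced. -/
noncomputable def pastOutputs (I : ℕ → Set ℕ) (x : ℕ → ℕ) : ℕ → Finset ℕ
  | 0 => ∅
  | n + 1 => insert (sInf (I n \ (seen x n ∪ pastOutputs I x n))) (pastOutputs I x n)

/-- The least element of `I n` that is neither seen nor already produced. -/
noncomputable def greedyOutput (I : ℕ → Set ℕ) (x : ℕ → ℕ) (n : ℕ) : ℕ :=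
  sInf (I n \ (seen x n ∪ pastOutputs I x n))

theorem mem_firstElems_iff {L : Set ℕ} (hL : L.Infinite) {y m : ℕ} :
    y ∈ firstElems L m ↔ y ∈ L ∧ position y L ≤ m := by
  classical
  have key : ∀ z ∈ L, position z L = Nat.count (· ∈ L) z + 1 := by
    intro z hz
    have h1 : {w | w ∈ L ∧ w ≤ z} = ((Finset.range (z + 1)).filter (· ∈ L) : Finset ℕ) := by
      ext w; simp [and_comm]
    rw [position, if_pos hz, h1, Set.ncard_coe_finset, ← Nat.count_eq_card_filter_range,
      Nat.count_succ, if_pos hz]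
  simp only [firstElems, Finset.mem_image, Finset.mem_range]
  constructor
  · rintro ⟨j, hj, rfl⟩
    have hmem : Nat.nth (· ∈ L) j ∈ L := Nat.nth_mem_of_infinite hL j
    refine ⟨hmem, ?_⟩
    rw [key _ hmem, Nat.count_nth_of_infinite (p := (· ∈ L)) hL]
    exact hj
  · rintro ⟨hy, hm⟩
    rw [key y hy] at hm
    exact ⟨_, hm, Nat.nth_count (p := (· ∈ L)) hy⟩

theorem position_le_position {L : Set ℕ} {y z : ℕ} (hz : z ∈ L) (hyz : y ≤ z) :
    position y L ≤ position z L := by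
  unfold position
  rw [if_pos hz]
  split_ifs
  · exact Set.ncard_le_ncard (fun w hw => ⟨hw.1, hw.2.trans hyz⟩)
      ((Set.finite_Iic z).subset fun w hw => hw.2)
  · exact Nat.zero_le _

open Classical in
theorem densityRatio_eq {A B : Set ℕ} (hB : B.Infinite) (m : ℕ) :
    densityRatio A B m = (((firstElems B m).filter (· ∈ A)).card : ℝ) / m := by
  have h1 : {j | j < m ∧ Nat.nth (· ∈ B) j ∈ A} =
      ((Finset.range m).filter (fun j => Nat.nth (· ∈ B) j ∈ A) : Finset ℕ) := by
    ext; simp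
  rw [densityRatio, h1, Set.ncard_coe_finset, firstElems, Finset.filter_image,
    Finset.card_image_of_injective _ (Nat.nth_injective (p := (· ∈ B)) hB)]

theorem le_lowDensity_of_forall_le {A B : Set ℕ} (hB : B.Infinite) {c C : ℝ}
    (h : ∀ m : ℕ, c * m - C ≤ m * densityRatio A B m) : c ≤ lowDensity A B := by
  classical
  refine le_of_forall_lt_imp_le_of_dense fun b hb => ?_
  refine Filter.le_liminf_of_le ?_ ?_
  · refine (isBoundedUnder_of ⟨1, fun m => ?_⟩).isCoboundedUnder_ge
    rw [densityRatio_eq hB]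
    refine div_le_one_of_le₀ ?_ (Nat.cast_nonneg _)
    exact_mod_cast (Finset.card_filter_le _ _).trans
      (Finset.card_image_le.trans (Finset.card_range m).le)
  · filter_upwards [eventually_gt_atTop 0, eventually_ge_atTop ⌈C / (c - b)⌉₊] with m hm hmC
    have h2 := Nat.ceil_le.mp hmC
    rw [div_le_iff₀ (sub_pos.mpr hb)] at h2
    have hm' : (0 : ℝ) < m := by exact_mod_cast hm
    refine le_of_mul_le_mul_left ?_ hm'
    linarith [h m]

theorem mem_pastOutputs_iff {I : ℕ → Set ℕ} {x : ℕ → ℕ} {n y : ℕ} :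
    y ∈ pastOutputs I x n ↔ ∃ t < n, greedyOutput I x t = y := by
  induction n with
  | zero => simp [pastOutputs]
  | succ n ih =>
    simp only [pastOutputs, Finset.mem_insert, ih, Nat.lt_succ_iff_lt_or_eq, greedyOutput]
    grind

theorem card_pastOutputs_le (I : ℕ → Set ℕ) (x : ℕ → ℕ) (n : ℕ) :
    (pastOutputs I x n).card ≤ n := by
  induction n with
  | zero => simp [pastOutputs]
  | succ n ih => exact (Finset.card_insert_le _ _).trans (by omega)

theorem greedyOutput_mem {I : ℕ → Set ℕ} {x : ℕ → ℕ} {n : ℕ} (hI : (I n).Infinite) :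
    greedyOutput I x n ∈ I n \ (seen x n ∪ pastOutputs I x n) := by
  refine Nat.sInf_mem (hI.sdiff ?_).nonempty
  exact ((Set.finite_lt_nat n).image x).union (Finset.finite_toSet _)

open Classical in
theorem infinite_of_forall_le_card {K S : Set ℕ} {θ : ℝ} (hθ : 0 < θ) {T : ℕ}
    (h : ∀ m ≥ T, θ * m ≤ (((firstElems K m).filter (· ∈ S)).card : ℝ)) : S.Infinite := by
  intro hS
  obtain ⟨m, hm⟩ := exists_nat_gt ((hS.toFinset.card : ℝ) / θ)
  have h1 := h (max m T) (le_max_right _ _)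
  have h2 : ((firstElems K (max m T)).filter (· ∈ S)).card ≤ hS.toFinset.card :=
    Finset.card_le_card fun y hy => by simpa using (Finset.mem_filter.mp hy).2
  have h3 : (m : ℝ) ≤ (max m T : ℕ) := by exact_mod_cast le_max_left _ _
  rw [div_lt_iff₀ hθ] at hm
  have h4 : (((firstElems K (max m T)).filter (· ∈ S)).card : ℝ) ≤ hS.toFinset.card := by
    exact_mod_cast h2
  nlinarith

open Classical in
theorem card_filter_range_greedyOutput_ge {K : Set ℕ} (hK : K.Infinite) {I : ℕ → Set ℕ}
    {x : ℕ → ℕ} {θ : ℝ} (hθ1 : θ ≤ 1) {T : ℕ} (hI : ∀ t ≥ T, (I t).Infinite)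
    (hIK : ∀ t ≥ T, I t ⊆ K)
    (hd : ∀ t ≥ T, ∀ m ≥ t, θ * m ≤ (((firstElems K m).filter (· ∈ I t)).card : ℝ)) (m : ℕ) :
    θ / 2 * m - (T + 1) ≤
      (((firstElems K m).filter (· ∈ Set.range (greedyOutput I x))).card : ℝ) := by
  have hout : ∀ t ≥ T, greedyOutput I x t ∈ I t \ (seen x t ∪ pastOutputs I x t) :=
    fun t ht => greedyOutput_mem (hI t ht)
  rcases lt_or_ge (θ / 2 * m) 0 with hneg | hpos
  · linarith [Nat.cast_nonneg (α := ℝ) T, Nat.cast_nonneg (α := ℝ)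
      ((firstElems K m).filter (· ∈ Set.range (greedyOutput I x))).card]
  set n := ⌊θ / 2 * m⌋₊ with hn
  have hn1 : (n : ℝ) ≤ θ / 2 * m := Nat.floor_le hpos
  have hn2 : θ / 2 * m < n + 1 := Nat.lt_floor_add_one _
  by_cases hall : ∀ t ∈ Finset.Ico T n, greedyOutput I x t ∈ firstElems K m
  · have hcard : (Finset.Ico T n).card ≤
        ((firstElems K m).filter (· ∈ Set.range (greedyOutput I x))).card := by
      refine Finset.card_le_card_of_injOn (greedyOutput I x)
        (fun t ht => by simpa using hall t ht) ?_
      have aux : ∀ s ≥ T, ∀ t, s < t → greedyOutput I x s ≠ greedyOutput I x t :=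
        fun s hs t hst he => (hout t (hs.trans hst.le)).2
          (Or.inr (Finset.mem_coe.mpr (mem_pastOutputs_iff.mpr ⟨s, hst, he⟩)))
      intro s hs t ht he
      simp only [Finset.coe_Ico, Set.mem_Ico] at hs ht
      rcases lt_trichotomy s t with h | h | h
      · exact absurd he (aux s hs.1 t h)
      · exact h
      · exact absurd he.symm (aux t ht.1 s h)
    rw [Nat.card_Ico] at hcard
    have : (n : ℝ) ≤ T +
        ((firstElems K m).filter (· ∈ Set.range (greedyOutput I x))).card := by
      exact_mod_cast (by omega : n ≤ T + _)
    linarith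
  · push Not at hall
    obtain ⟨t, ht, hnot⟩ := hall
    rw [Finset.mem_Ico] at ht
    have htm : t ≤ m := by
      have : (t : ℝ) ≤ n := by exact_mod_cast ht.2.le
      have hm0 : (0 : ℝ) ≤ m := Nat.cast_nonneg m
      exact_mod_cast (by nlinarith : (t : ℝ) ≤ m)
    have hsub : (firstElems K m).filter (· ∈ I t) ⊆
        (Finset.range t).image x ∪
          (firstElems K m).filter (· ∈ Set.range (greedyOutput I x)) := by
      intro y hy
      rw [Finset.mem_filter] at hy
      by_contra hcon
      rw [Finset.mem_union, not_or] at hcon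
      have hle : greedyOutput I x t ≤ y := by
        refine Nat.sInf_le ⟨hy.2, ?_⟩
        rintro (⟨s, hs, rfl⟩ | hp)
        · exact hcon.1 (Finset.mem_image_of_mem x (Finset.mem_range.mpr hs))
        · obtain ⟨s, -, rfl⟩ := mem_pastOutputs_iff.mp (Finset.mem_coe.mp hp)
          exact hcon.2 (Finset.mem_filter.mpr ⟨hy.1, s, rfl⟩)
      have hyK := (mem_firstElems_iff hK).mp hy.1
      exact hnot ((mem_firstElems_iff hK).mpr
        ⟨hIK t ht.1 (hout t ht.1).1, (position_le_position hyK.1 hle).trans hyK.2⟩)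
    have hcard := (Finset.card_le_card hsub).trans (Finset.card_union_le _ _)
    have himg : ((Finset.range t).image x).card ≤ t := by
      simpa using Finset.card_image_le (s := Finset.range t) (f := x)
    have h1 := hd t ht.1 m htm
    have h2 : (((firstElems K m).filter (· ∈ I t)).card : ℝ) ≤
        t + ((firstElems K m).filter (· ∈ Set.range (greedyOutput I x))).card := by
      exact_mod_cast hcard.trans (by omega)
    have h3 : (t : ℝ) ≤ n := by exact_mod_cast ht.2.le
    linarith [Nat.cast_nonneg (α := ℝ) T]

section Congruence

variable {x y : ℕ → ℕ} {n : ℕ}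

theorem seen_congr (h : ∀ t < n, x t = y t) : seen x n = seen y n :=
  Set.image_congr h

theorem noiseRate_congr (L : Set ℕ) (h : ∀ t < n, x t = y t) :
    noiseRate L x n = noiseRate L y n := by
  have : {t | t < n ∧ x t ∉ L} = {t | t < n ∧ y t ∉ L} := by
    ext t
    simp only [Set.mem_ofPred_eq]
    refine and_congr_right fun ht => ?_
    rw [h t ht]
  rw [noiseRate, noiseRate, this]

theorem penalty_congr (𝓛 : ℕ → Set ℕ) (ε M : ℝ) (h : ∀ t < n, x t = y t) (j : ℕ) :
    penalty 𝓛 ε M x n j = penalty 𝓛 ε M y n j := by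
  classical
  unfold penalty
  rw [Nat.count_eq_card_filter_range, Nat.count_eq_card_filter_range]
  congr 2
  refine Finset.filter_congr fun s hs => ?_
  rw [Finset.mem_range] at hs
  unfold Violation
  rw [h s hs, noiseRate_congr (𝓛 j) fun t ht => h t (by omega)]

theorem target_congr (𝓛 : ℕ → Set ℕ) (ε M : ℝ) (h : ∀ t < n, x t = y t) :
    target 𝓛 ε M x n = target 𝓛 ε M y n := by
  have : candidates 𝓛 ε M x n = candidates 𝓛 ε M y n := by
    funext v
    simp only [candidates, penalty_congr 𝓛 ε M h]
  unfold target
  rw [this]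

theorem pastOutputs_congr {I J : ℕ → Set ℕ} (h : ∀ t < n, x t = y t)
    (hIJ : ∀ t < n, I t = J t) : pastOutputs I x n = pastOutputs J y n := by
  induction n with
  | zero => rfl
  | succ n ih =>
    have ht : ∀ t < n, x t = y t := fun t ht => h t (by omega)
    simp only [pastOutputs]
    rw [ih ht fun t ht => hIJ t (by omega), seen_congr ht, hIJ n (by omega)]

theorem greedyOutput_target_congr (𝓛 : ℕ → Set ℕ) (ε M : ℝ) (h : ∀ t < n, x t = y t) :
    greedyOutput (target 𝓛 ε M x) x n = greedyOutput (target 𝓛 ε M y) y n := by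
  unfold greedyOutput
  rw [seen_congr h, target_congr 𝓛 ε M h, pastOutputs_congr h fun t ht =>
    target_congr 𝓛 ε M fun s hs => h s (hs.trans ht)]

end Congruence

theorem sum_tolerance_le {ε : ℝ} (hε : 0 ≤ ε) (F : Finset ℕ) :
    ∑ j ∈ F, tolerance ε j ≤ ε / 2 := by
  have hs : HasSum (fun j : ℕ => (1 / 2 : ℝ) ^ (j + 1)) 1 := by
    simpa [pow_succ, div_eq_mul_inv] using hasSum_geometric_two.mul_right (1 / 2 : ℝ)
  simp only [tolerance]
  rw [← Finset.mul_sum]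
  have := sum_le_hasSum F (fun j _ => by positivity) hs
  nlinarith

theorem eventually_not_violation {L : Set ℕ} {δ M : ℝ} (hδ : 0 < δ) {x : ℕ → ℕ}
    (hb : MBounded x L M) (hn : Tendsto (noiseRate L x) atTop (nhds 0)) :
    ∀ᶠ s in atTop, ¬ Violation L δ M x s := by
  obtain ⟨N, hN⟩ := hb
  filter_upwards [eventually_ge_atTop N,
    (tendsto_add_atTop_nat 1).eventually (hn.eventually (gt_mem_nhds hδ))] with s hs hs'
  rintro (h | h)
  · exact absurd (hN s hs) (not_le.mpr h)
  · exact lt_asymm h hs'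

open Classical in
theorem penalty_mono (𝓛 : ℕ → Set ℕ) (ε M : ℝ) (x : ℕ → ℕ) (j : ℕ) :
    Monotone fun n => penalty 𝓛 ε M x n j :=
  fun _ _ h => Nat.add_le_add_left (Nat.count_monotone _ h) j

theorem exists_forall_penalty_le_iff {𝓛 : ℕ → Set ℕ} {ε M : ℝ} {x : ℕ → ℕ} {j : ℕ} :
    (∃ p, ∀ n, penalty 𝓛 ε M x n j ≤ p) ↔
      ∀ᶠ s in atTop, ¬ Violation (𝓛 j) (tolerance ε j) M x s := by
  classical
  rw [← Nat.cofinite_eq_atTop, Filter.eventually_cofinite]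
  simp only [not_not]
  constructor
  · rintro ⟨p, hp⟩
    by_contra hinf
    have h := hp (Nat.nth (Violation (𝓛 j) (tolerance ε j) M x) (p + 1))
    rw [penalty, Nat.count_nth_of_infinite
      (p := Violation (𝓛 j) (tolerance ε j) M x) hinf] at h
    omega
  · intro hfin
    exact ⟨_, fun n => Nat.add_le_add_left
      (Nat.count_le_card (p := Violation (𝓛 j) (tolerance ε j) M x) hfin n) j⟩

theorem eventually_candidates_eq (𝓛 : ℕ → Set ℕ) (ε M : ℝ) (x : ℕ → ℕ) (p : ℕ) :
    ∃ F : Finset ℕ, (∀ j, j ∈ F ↔ ∀ n, penalty 𝓛 ε M x n j ≤ p) ∧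
      ∀ᶠ n in atTop, candidates 𝓛 ε M x n p = F := by
  classical
  refine ⟨(Finset.range (p + 1)).filter fun j => ∀ n, penalty 𝓛 ε M x n j ≤ p, ?_, ?_⟩
  · intro j
    simp only [Finset.mem_filter, Finset.mem_range, and_iff_right_iff_imp]
    intro h
    have := h 0
    simp only [penalty] at this
    omega
  · have : ∀ᶠ n in atTop, ∀ j ∈ Finset.range (p + 1),
        (penalty 𝓛 ε M x n j ≤ p ↔ ∀ k, penalty 𝓛 ε M x k j ≤ p) := by
      rw [Filter.eventually_all_finset]
      intro j _
      by_cases h : ∀ k, penalty 𝓛 ε M x k j ≤ p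
      · exact Eventually.of_forall fun n => ⟨fun _ => h, fun _ => h n⟩
      · obtain ⟨k, hk⟩ := not_forall.mp h
        filter_upwards [eventually_ge_atTop k] with n hn
        exact iff_of_false (fun h' => hk ((penalty_mono 𝓛 ε M x j hn).trans h')) h
    filter_upwards [this] with n hn
    exact Finset.filter_congr hn

theorem eventually_denseFrom {𝓛 : ℕ → Set ℕ} (hinf : ∀ i, (𝓛 i).Infinite) {ε M : ℝ}
    (hε : ε ∈ Set.Ioo (0 : ℝ) 1) (hM : 1 ≤ M) {x : ℕ → ℕ} (hx : Function.Injective x)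
    {F : Finset ℕ}
    (hF : ∀ j ∈ F, ∀ᶠ s in atTop, ¬ Violation (𝓛 j) (tolerance ε j) M x s) :
    ∀ᶠ n in atTop, DenseFrom 𝓛 ((1 - ε) / M) n F := by
  classical
  obtain ⟨N, hN⟩ := eventually_atTop.mp ((Filter.eventually_all_finset F).mpr hF)
  have hM0 : 0 < M := by linarith
  filter_upwards [eventually_ge_atTop ⌈M * (N + 1)⌉₊,
    eventually_ge_atTop ⌈2 * M * (N + 1) / ε⌉₊] with n hn1 hn2
  intro i hi m hm
  have hm1 : M * (N + 1) ≤ m := (Nat.ceil_le.mp hn1).trans (by exact_mod_cast hm)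
  have hm2 : 2 * M * (N + 1) / ε ≤ m := (Nat.ceil_le.mp hn2).trans (by exact_mod_cast hm)
  rw [div_le_iff₀ hε.1] at hm2
  set k := ⌊(m : ℝ) / M⌋₊ with hk
  have hk1 : (k : ℝ) ≤ m / M := Nat.floor_le (by positivity)
  have hk2 : (m : ℝ) / M < k + 1 := Nat.lt_floor_add_one _
  have hkN : N + 1 ≤ k := by
    refine Nat.le_floor ?_
    rw [le_div_iff₀ hM0]
    push_cast
    linarith
  have hkM : M * k ≤ m := by rw [le_div_iff₀ hM0] at hk1; linarith
  have hk0 : (0 : ℝ) < k := by exact_mod_cast (by omega : 0 < k)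
  have hbad : ∀ j ∈ F, (((Finset.range k).filter (x · ∉ 𝓛 j)).card : ℝ) ≤ tolerance ε j * k := by
    intro j hj
    have h := hN (k - 1) (by omega) j hj
    simp only [Violation, not_or, not_lt] at h
    have h2 := h.2
    rw [Nat.sub_add_cancel (by omega), noiseRate, div_le_iff₀ hk0] at h2
    have hset : {t | t < k ∧ x t ∉ 𝓛 j} =
        ((Finset.range k).filter (x · ∉ 𝓛 j) : Finset ℕ) := by
      ext; simp
    rwa [hset, Set.ncard_coe_finset] at h2
  have hcover : Finset.range k ⊆
      (Finset.range N ∪ F.biUnion fun j => (Finset.range k).filter (x · ∉ 𝓛 j)) ∪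
      (Finset.Ico N k).filter (x · ∈ commonPart 𝓛 F) := by
    intro t ht
    rw [Finset.mem_range] at ht
    rw [Finset.mem_union, Finset.mem_union, Finset.mem_biUnion, Finset.mem_range]
    by_cases h1 : t < N
    · exact Or.inl (Or.inl h1)
    by_cases h2 : x t ∈ commonPart 𝓛 F
    · exact Or.inr (Finset.mem_filter.mpr ⟨Finset.mem_Ico.mpr ⟨by omega, ht⟩, h2⟩)
    · obtain ⟨j, hj, hj'⟩ : ∃ j ∈ F, x t ∉ 𝓛 j := by
        by_contra! h3
        exact h2 h3
      exact Or.inl (Or.inr ⟨j, hj, Finset.mem_filter.mpr ⟨Finset.mem_range.mpr ht, hj'⟩⟩)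
  have hcard : k ≤ N + ∑ j ∈ F, ((Finset.range k).filter (x · ∉ 𝓛 j)).card +
      ((Finset.Ico N k).filter (x · ∈ commonPart 𝓛 F)).card := by
    have h1 := (Finset.card_le_card hcover).trans (Finset.card_union_le _ _)
    have h2 := Finset.card_union_le (Finset.range N)
      (F.biUnion fun j => (Finset.range k).filter (x · ∉ 𝓛 j))
    have h3 := Finset.card_biUnion_le (s := F)
      (t := fun j => (Finset.range k).filter (x · ∉ 𝓛 j))
    rw [Finset.card_range] at h1 h2
    omega
  have hgood : ((Finset.Ico N k).filter (x · ∈ commonPart 𝓛 F)).card ≤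
      ((firstElems (𝓛 i) m).filter (· ∈ commonPart 𝓛 F)).card := by
    refine Finset.card_le_card_of_injOn x (fun t ht => ?_) hx.injOn
    simp only [Finset.coe_filter, Finset.mem_Ico, Set.mem_ofPred_eq] at ht ⊢
    refine ⟨(mem_firstElems_iff (hinf i)).mpr ⟨ht.2 i hi, ?_⟩, ht.2⟩
    have h := hN t ht.1.1 i hi
    simp only [Violation, not_or, not_lt] at h
    have htk : (t : ℝ) + 1 ≤ k := by exact_mod_cast ht.1.2
    exact_mod_cast h.1.trans ((mul_le_mul_of_nonneg_left htk hM0.le).trans hkM)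
  have hsum : ((∑ j ∈ F, ((Finset.range k).filter (x · ∉ 𝓛 j)).card : ℕ) : ℝ) ≤ ε / 2 * k := by
    push_cast
    refine (Finset.sum_le_sum hbad).trans ?_
    rw [← Finset.sum_mul]
    exact mul_le_mul_of_nonneg_right (sum_tolerance_le hε.1.le F) hk0.le
  have hcard' : (k : ℝ) ≤
      N + ((∑ j ∈ F, ((Finset.range k).filter (x · ∉ 𝓛 j)).card : ℕ) : ℝ) +
      ((firstElems (𝓛 i) m).filter (· ∈ commonPart 𝓛 F)).card := by
    exact_mod_cast hcard.trans (by omega)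
  have hm3 : N + 1 ≤ ε / 2 * (m / M) := by
    rw [← mul_div_assoc, le_div_iff₀ hM0]
    linarith
  have h1 : (1 - ε) / M * m = (1 - ε) * (m / M) := by ring
  rw [h1]
  nlinarith [hε.1, hε.2]

open Classical in
theorem exists_forall_target_subset_and_dense {𝓛 : ℕ → Set ℕ} (hinf : ∀ i, (𝓛 i).Infinite)
    {ε M : ℝ} (hε : ε ∈ Set.Ioo (0 : ℝ) 1) (hM : 1 ≤ M) {x : ℕ → ℕ} (hx : Function.Injective x)
    {i : ℕ} (hb : MBounded x (𝓛 i) M) (hn : Tendsto (noiseRate (𝓛 i) x) atTop (nhds 0)) :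
    ∃ T, ∀ t ≥ T, target 𝓛 ε M x t ⊆ 𝓛 i ∧ ∀ m ≥ t,
      (1 - ε) / M * m ≤
        (((firstElems (𝓛 i) m).filter (· ∈ target 𝓛 ε M x t)).card : ℝ) := by
  have htol : 0 < tolerance ε i := mul_pos (half_pos hε.1) (by positivity)
  obtain ⟨p, hp⟩ := exists_forall_penalty_le_iff.mpr (eventually_not_violation htol hb hn)
  obtain ⟨F, hF, hcand⟩ := eventually_candidates_eq 𝓛 ε M x p
  have hdense := eventually_denseFrom hinf hε hM hx (F := F) fun j hj =>
    exists_forall_penalty_le_iff.mp ⟨p, (hF j).mp hj⟩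
  rw [← eventually_atTop]
  filter_upwards [hcand, hdense, eventually_ge_atTop p] with t hct hdt hpt
  rw [← hct] at hdt
  set P := fun v => DenseFrom 𝓛 ((1 - ε) / M) t (candidates 𝓛 ε M x t v) with hP
  have hspec : P (Nat.findGreatest P t) := Nat.findGreatest_spec (P := P) hpt hdt
  have hge : p ≤ Nat.findGreatest P t := Nat.le_findGreatest hpt hdt
  have hmem : i ∈ candidates 𝓛 ε M x t (Nat.findGreatest P t) := by
    have h1 := hp t
    have h2 : i ≤ penalty 𝓛 ε M x t i := Nat.le_add_right _ _
    simp only [candidates, Finset.mem_filter, Finset.mem_range]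
    omega
  exact ⟨fun y hy => hy i hmem, hspec i hmem⟩

/-- Element-based generation with lower density `(1-ε)/(2M)` under `M`-bounded displacement
enumerations with `o(1)`-noise and arbitrary omissions, for every countable collection. -/
theorem element_based_density_bounded_adversary
    (𝓛 : ℕ → Set ℕ) (hinf : ∀ i, (𝓛 i).Infinite)
    (ε : ℝ) (hε : ε ∈ Set.Ioo (0:ℝ) 1) (M : ℝ) (hM : 1 ≤ M) :
    ∃ G : List ℕ → ℕ, ∀ istar : ℕ, ∀ x : ℕ → ℕ,
      Function.Injective x →
      MBounded x (𝓛 istar) M →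
      {n : ℕ | x n ∈ 𝓛 istar}.Infinite →
      Filter.Tendsto (noiseRate (𝓛 istar) x) Filter.atTop (nhds 0) →
      (∃ nstar : ℕ, ∀ n ≥ nstar, G (prefixList x n) ∈ 𝓛 istar \ seen x n) ∧
      lowDensity (Set.range fun n => G (prefixList x n)) (𝓛 istar) ≥ (1 - ε) / (2 * M) := by
  classical
  refine ⟨fun l => greedyOutput (target 𝓛 ε M fun t => l.getD t 0) (fun t => l.getD t 0) l.length,
    fun istar x hx hb _ hn => ?_⟩
  have hG : (fun n => greedyOutput (target 𝓛 ε M fun t => (prefixList x n).getD t 0)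
      (fun t => (prefixList x n).getD t 0) (prefixList x n).length) =
      greedyOutput (target 𝓛 ε M x) x := by
    funext n
    have hlen : (prefixList x n).length = n := by simp [prefixList]
    rw [hlen]
    refine greedyOutput_target_congr 𝓛 ε M fun t ht => ?_
    simp [prefixList, ht]
  obtain ⟨T, hT⟩ := exists_forall_target_subset_and_dense hinf hε hM hx hb hn
  have hM0 : 0 < M := by linarith
  have hθ : 0 < (1 - ε) / M := div_pos (by linarith [hε.2]) hM0
  have hθ1 : (1 - ε) / M ≤ 1 := by rw [div_le_one hM0]; linarith [hε.1]
  have hI : ∀ t ≥ T, (target 𝓛 ε M x t).Infinite :=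
    fun t ht => infinite_of_forall_le_card hθ (hT t ht).2
  refine ⟨⟨T, fun n hnT => ?_⟩, ?_⟩
  · have h := greedyOutput_mem (x := x) (hI n hnT)
    rw [← congrFun hG n] at h
    exact ⟨(hT n hnT).1 h.1, fun hs => h.2 (Or.inl hs)⟩
  · beta_reduce
    rw [hG]
    have hhalf : (1 - ε) / (2 * M) = (1 - ε) / M / 2 := by field_simp
    rw [hhalf]
    refine le_lowDensity_of_forall_le (hinf istar) (C := T + 1) fun m => ?_
    refine (card_filter_range_greedyOutput_ge (x := x) (hinf istar) hθ1 hI (fun t ht => (hT t ht).1)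
      (fun t ht => (hT t ht).2) m).trans ?_
    rw [densityRatio_eq (hinf istar)]
    rcases Nat.eq_zero_or_pos m with rfl | hm
    · simp [firstElems]
    · rw [mul_div_cancel₀ _ (by positivity)]
end

section
/- For every positive integer M there exist infinite sets L₁ ⊆ L₂ ⊆ ℕ with μ_up(L₁, L₂) = 1/M and an injective sequence x : ℕ → ℕ with range(x) = L₂ such that x is an M-bounded displacement enumeration with respect to both L₁ and L₂, R(L₂; x_{1:n}) = 0 for all n, and lim_{n→∞} R(L₁; x_{1:n}) = 0, and such that every set-based generator G : List ℕ → Set ℕ that generates in the limit from L₁ under x satisfies limsup_{n→∞} μ_low(G(x_1,…,x_n), L₂) ≤ 1/M. Consequently, under M-bounded displacement enumerations with o(1)-noise, no set-based generator generating in the limit from the collection {L₁, L₂} achieves set-based upper density greater than 1/M. -/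
open Filter Set Topology

section Density

lemma densityRatio_univ (A : Set ℕ) (m : ℕ) :
    densityRatio A univ m = (({j | j < m ∧ j ∈ A}).ncard : ℝ) / m := by
  have h : ∀ j, Nat.nth (· ∈ (univ : Set ℕ)) j = j := fun j => by simp
  simp only [densityRatio, h]

lemma densityRatio_nonneg (A B : Set ℕ) (m : ℕ) : 0 ≤ densityRatio A B m := by
  unfold densityRatio; positivity

lemma densityRatio_mono {A A' : Set ℕ} (h : A ⊆ A') (B : Set ℕ) (m : ℕ) :
    densityRatio A B m ≤ densityRatio A' B m := by
  unfold densityRatio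
  gcongr
  exact (Set.finite_lt_nat m).subset fun j hj => hj.1

lemma densityRatio_le_one (A B : Set ℕ) (m : ℕ) : densityRatio A B m ≤ 1 := by
  unfold densityRatio
  apply div_le_one_of_le₀ _ (Nat.cast_nonneg m)
  have h := Set.ncard_le_ncard
    (show {j | j < m ∧ Nat.nth (· ∈ B) j ∈ A} ⊆ Set.Iio m from fun j hj => hj.1)
  rw [Set.ncard_Iio_nat] at h
  exact_mod_cast h

lemma isBoundedUnder_ge_densityRatio (A B : Set ℕ) :
    IsBoundedUnder (· ≥ ·) atTop (densityRatio A B) :=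
  isBoundedUnder_of ⟨0, densityRatio_nonneg A B⟩

lemma isBoundedUnder_le_densityRatio (A B : Set ℕ) :
    IsBoundedUnder (· ≤ ·) atTop (densityRatio A B) :=
  isBoundedUnder_of ⟨1, densityRatio_le_one A B⟩

lemma lowDensity_nonneg (A B : Set ℕ) : 0 ≤ lowDensity A B :=
  le_liminf_of_le (isBoundedUnder_le_densityRatio A B).isCoboundedUnder_ge
    (Eventually.of_forall (densityRatio_nonneg A B))

lemma lowDensity_mono {A A' : Set ℕ} (h : A ⊆ A') (B : Set ℕ) :
    lowDensity A B ≤ lowDensity A' B :=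
  liminf_le_liminf (Eventually.of_forall (densityRatio_mono h B))
    (isBoundedUnder_ge_densityRatio A B)
    (isBoundedUnder_le_densityRatio A' B).isCoboundedUnder_ge

lemma tendsto_densityRatio_multiples {M : ℕ} (hM : 0 < M) :
    Tendsto (densityRatio {y | M ∣ y} univ) atTop (𝓝 (1 / (M : ℝ))) := by
  have hM' : (0 : ℝ) < M := by exact_mod_cast hM
  have hcard : ∀ m : ℕ, ({j | j < m ∧ j ∈ {y | M ∣ y}}).ncard
      = m / M + if 0 < m % M then 1 else 0 := by
    intro m
    have h := Nat.count_modEq_card m hM 0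
    rw [Nat.count_eq_card_filter_range] at h
    rw [Nat.zero_mod] at h
    rw [← h, ← Set.ncard_coe_finset]
    congr 1
    ext j
    simp [Nat.modEq_zero_iff_dvd]
  have hlow : ∀ m : ℕ, (m : ℝ) / M ≤ ({j | j < m ∧ j ∈ {y | M ∣ y}}).ncard := by
    intro m
    rw [div_le_iff₀ hM', hcard]
    have h := Nat.div_add_mod m M
    have h2 := Nat.mod_lt m hM
    norm_cast
    split_ifs <;> nlinarith
  have hup : ∀ m : ℕ, (({j | j < m ∧ j ∈ {y | M ∣ y}}).ncard : ℝ) ≤ m / M + 1 := by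
    intro m
    rw [hcard]
    have h : ((m / M : ℕ) : ℝ) ≤ m / M := Nat.cast_div_le
    push_cast
    split_ifs <;> linarith
  have hlim : Tendsto (fun m : ℕ => 1 / (M : ℝ) + 1 / (m : ℝ)) atTop (𝓝 (1 / (M : ℝ))) := by
    simpa using (tendsto_const_nhds (x := 1 / (M : ℝ))).add
      (tendsto_one_div_atTop_nhds_zero_nat (𝕜 := ℝ))
  refine tendsto_of_tendsto_of_tendsto_of_le_of_le' tendsto_const_nhds hlim ?_ ?_
  · filter_upwards [eventually_gt_atTop 0] with m hm
    have hm' : (0 : ℝ) < m := by exact_mod_cast hm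
    rw [densityRatio_univ, le_div_iff₀ hm']
    calc 1 / (M : ℝ) * m = m / M := by ring
      _ ≤ _ := hlow m
  · filter_upwards [eventually_gt_atTop 0] with m hm
    have hm' : (0 : ℝ) < m := by exact_mod_cast hm
    rw [densityRatio_univ, div_le_iff₀ hm']
    calc _ ≤ (m : ℝ) / M + 1 := hup m
      _ = (1 / (M : ℝ) + 1 / m) * m := by field_simp

/-- A generator whose outputs eventually lie in `L` has upper set-based density at most the
lower density of `L`. -/
lemma limsup_lowDensity_le {L B : Set ℕ} {A : ℕ → Set ℕ} (h : ∀ᶠ n in atTop, A n ⊆ L) :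
    limsup (fun n => lowDensity (A n) B) atTop ≤ lowDensity L B :=
  limsup_le_of_le
    (isBoundedUnder_of ⟨0, fun n => lowDensity_nonneg (A n) B⟩ :
      IsBoundedUnder (· ≥ ·) atTop _).isCoboundedUnder_le
    (h.mono fun _ hn => lowDensity_mono hn B)

end Density

section Position

lemma position_le (y : ℕ) (L : Set ℕ) : position y L ≤ y + 1 := by
  unfold position
  split_ifs
  · have h := Set.ncard_le_ncard
      (show {z | z ∈ L ∧ z ≤ y} ⊆ Set.Iio (y + 1) from fun z hz => Nat.lt_succ_of_le hz.2)
    rwa [Set.ncard_Iio_nat] at h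
  · exact Nat.zero_le _

lemma mBounded_of_lt {x : ℕ → ℕ} {M : ℕ} (h : ∀ n, x n + 1 ≤ M * (n + 1)) (L : Set ℕ) :
    MBounded x L M :=
  ⟨0, fun n _ => by exact_mod_cast (position_le (x n) L).trans (h n)⟩

end Position

section Interleave

open Classical in
/-- The stream listing `p` in increasing order at the times in `T`, and listing the complement
of `p` in increasing order at the other times. -/
noncomputable def interleave (T p : ℕ → Prop) (n : ℕ) : ℕ :=
  if T n then Nat.nth p (Nat.count T n)
  else Nat.nth (fun y => ¬ p y) (Nat.count (fun t => ¬ T t) n)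

variable {T p : ℕ → Prop}

lemma interleave_mem_iff (hp : {y | p y}.Infinite) (hp' : {y | ¬ p y}.Infinite) (n : ℕ) :
    p (interleave T p n) ↔ T n := by
  unfold interleave
  split_ifs with h
  · simpa [h] using Nat.nth_mem_of_infinite hp _
  · simpa [h] using Nat.nth_mem_of_infinite hp' _

lemma interleave_injective (hp : {y | p y}.Infinite) (hp' : {y | ¬ p y}.Infinite) :
    Function.Injective (interleave T p) := by
  classical
  intro a b hab
  have hT : T a ↔ T b := by
    rw [← interleave_mem_iff (T := T) hp hp', hab, interleave_mem_iff hp hp']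
  unfold interleave at hab
  by_cases ha : T a
  · have hb := hT.1 ha
    rw [if_pos ha, if_pos hb] at hab
    exact Nat.count_injective ha hb (Nat.nth_injective hp (by convert hab))
  · have hb := fun h => ha (hT.2 h)
    rw [if_neg ha, if_neg hb] at hab
    exact Nat.count_injective (p := fun t => ¬ T t) ha hb (Nat.nth_injective hp' (by convert hab))

lemma interleave_surjective (hT : {t | T t}.Infinite) (hT' : {t | ¬ T t}.Infinite) :
    Function.Surjective (interleave T p) := by
  classical
  intro y
  by_cases hy : p y
  · refine ⟨Nat.nth T (Nat.count p y), ?_⟩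
    unfold interleave
    rw [if_pos (Nat.nth_mem_of_infinite hT _), Nat.count_nth_of_infinite hT, Nat.nth_count hy]
  · refine ⟨Nat.nth (fun t => ¬ T t) (Nat.count (fun y => ¬ p y) y), ?_⟩
    unfold interleave
    rw [if_neg (Nat.nth_mem_of_infinite hT' _), Nat.count_nth_of_infinite hT',
      Nat.nth_count (p := fun y => ¬ p y) hy]

lemma interleave_le {C : ℕ} (h : ∀ k, Nat.nth p k ≤ C * k + (C - 1))
    (h' : ∀ k, Nat.nth (fun y => ¬ p y) k ≤ C * k + (C - 1)) (n : ℕ) :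
    interleave T p n ≤ C * n + (C - 1) := by
  classical
  unfold interleave
  split_ifs
  · exact (h _).trans (by gcongr; exact Nat.count_le _)
  · exact (h' _).trans (by gcongr; exact Nat.count_le _)

end Interleave

lemma nth_dvd {M : ℕ} (hM : 0 < M) (k : ℕ) : Nat.nth (M ∣ ·) k = M * k := by
  have hinf : {y | M ∣ y}.Infinite :=
    Set.infinite_of_injective_forall_mem (f := fun k => M * k)
      (fun a b h => Nat.eq_of_mul_eq_mul_left hM h) (fun k => Dvd.intro k rfl)
  have hmono : StrictMono fun k => M * k := fun a b h => Nat.mul_lt_mul_of_pos_left h hM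
  have hr : range (fun k => M * k) = {y | M ∣ y} := by
    ext y; exact ⟨fun ⟨k, hk⟩ => ⟨k, hk.symm⟩, fun ⟨k, hk⟩ => ⟨k, hk.symm⟩⟩
  exact congrFun ((StrictMono.range_inj (Nat.nth_strictMono hinf) hmono).1
    ((Nat.range_nth_of_infinite hinf).trans hr.symm)) k

lemma infinite_not_dvd {M : ℕ} (hM : 2 ≤ M) : {y | ¬ M ∣ y}.Infinite := by
  refine Set.infinite_of_injective_forall_mem (f := fun k => M * k + 1)
    (fun a b h => Nat.eq_of_mul_eq_mul_left (by omega) (Nat.succ.inj h)) fun k hk => ?_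
  have h := (Nat.dvd_add_right (Dvd.intro k rfl)).1 hk
  have := Nat.le_of_dvd one_pos h
  omega

lemma nth_not_dvd_le {M : ℕ} (hM : 2 ≤ M) (k : ℕ) : Nat.nth (¬ M ∣ ·) k ≤ 2 * k + 1 := by
  classical
  have hone : ¬ M ∣ 1 := fun h => by have := Nat.le_of_dvd one_pos h; omega
  induction k with
  | zero =>
    have h := Nat.nth_count (p := (¬ M ∣ ·)) hone
    simp only [Nat.count_succ, Nat.count_zero, dvd_zero, not_true_eq_false, if_false] at h
    simpa using h.le
  | succ k ih =>
    by_contra! hlt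
    have hstep : ∀ y, Nat.nth (¬ M ∣ ·) k < y → y < Nat.nth (¬ M ∣ ·) (k + 1) → M ∣ y := by
      intro y h1 h2
      by_contra hy
      have := Nat.le_nth_of_lt_nth_succ h2 hy
      omega
    have h1 := hstep (2 * k + 2) (by omega) (by omega)
    have h2 := hstep (2 * k + 3) (by omega) (by omega)
    exact hone ((Nat.dvd_add_right h1).1 h2)

lemma infinite_isSquare : {t : ℕ | IsSquare t}.Infinite :=
  Set.infinite_of_injective_forall_mem (f := fun k => k * k)
    (fun _ _ h => Nat.mul_self_inj.1 h) fun k => ⟨k, rfl⟩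

lemma infinite_not_isSquare : {t : ℕ | ¬ IsSquare t}.Infinite := by
  refine Set.infinite_of_injective_forall_mem (f := fun k => (k + 1) * (k + 1) + 1)
    (fun a b h => by simpa using Nat.mul_self_inj.1 (Nat.succ.inj h)) ?_
  rintro k ⟨r, hr⟩
  rcases le_or_gt r (k + 1) with h | h <;> nlinarith

lemma ncard_isSquare_lt_le (n : ℕ) : {t | t < n ∧ IsSquare t}.ncard ≤ Nat.sqrt n + 1 := by
  have hsub : {t | t < n ∧ IsSquare t} ⊆ (fun k => k * k) '' Set.Iio (Nat.sqrt n + 1) := by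
    rintro _ ⟨ht, r, rfl⟩
    exact ⟨r, Nat.lt_succ_of_le (Nat.le_sqrt.2 ht.le), rfl⟩
  calc _ ≤ _ := Set.ncard_le_ncard hsub ((Set.finite_Iio _).image _)
    _ ≤ (Set.Iio (Nat.sqrt n + 1)).ncard := Set.ncard_image_le (Set.finite_Iio _)
    _ = _ := Set.ncard_Iio_nat _

/-- Noise that occurs only at square times has vanishing rate. -/
lemma tendsto_noiseRate_of_isSquare {L : Set ℕ} {x : ℕ → ℕ} (h : ∀ t, x t ∉ L → IsSquare t) :
    Tendsto (noiseRate L x) atTop (𝓝 0) := by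
  have hlim : Tendsto (fun n : ℕ => 1 / Real.sqrt n + 1 / (n : ℝ)) atTop (𝓝 0) := by
    have h1 : Tendsto (fun n : ℕ => 1 / Real.sqrt n) atTop (𝓝 0) := by
      simpa [Function.comp_def, Pi.inv_def] using
        (Real.tendsto_sqrt_atTop.comp tendsto_natCast_atTop_atTop).inv_tendsto_atTop
    simpa using h1.add (tendsto_one_div_atTop_nhds_zero_nat (𝕜 := ℝ))
  refine squeeze_zero (fun n => by unfold noiseRate; positivity) (fun n => ?_) hlim
  have hcard : {t | t < n ∧ x t ∉ L}.ncard ≤ Nat.sqrt n + 1 :=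
    (Set.ncard_le_ncard (t := {t | t < n ∧ IsSquare t}) (fun t ht => ⟨ht.1, h t ht.2⟩)
      ((Set.finite_lt_nat n).subset fun t ht => ht.1)).trans (ncard_isSquare_lt_le n)
  have hcard' : ({t | t < n ∧ x t ∉ L}.ncard : ℝ) ≤ Real.sqrt n + 1 :=
    calc _ ≤ ((Nat.sqrt n + 1 : ℕ) : ℝ) := by exact_mod_cast hcard
      _ ≤ _ := by push_cast; gcongr; exact Real.nat_sqrt_le_real_sqrt
  calc noiseRate L x n ≤ (Real.sqrt n + 1) / n := by unfold noiseRate; gcongr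
    _ = 1 / Real.sqrt n + 1 / n := by rw [add_div, Real.sqrt_div_self']

lemma exists_bounded_permutation {M : ℕ} (hM : 0 < M) :
    ∃ x : ℕ → ℕ, Function.Injective x ∧ Function.Surjective x ∧
      (∀ n, x n + 1 ≤ M * (n + 1)) ∧ ∀ n, ¬ M ∣ x n → IsSquare n := by
  rcases (show M = 1 ∨ 2 ≤ M by omega) with rfl | hM2
  · exact ⟨id, Function.injective_id, Function.surjective_id, by simp, by simp⟩
  have hinf : {y | ¬ ¬ M ∣ y}.Infinite := by
    simp only [not_not]
    exact Set.infinite_of_injective_forall_mem (f := fun k => M * k)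
      (fun a b h => Nat.eq_of_mul_eq_mul_left hM h) (fun k => Dvd.intro k rfl)
  refine ⟨interleave IsSquare (¬ M ∣ ·), interleave_injective (infinite_not_dvd hM2) hinf,
    interleave_surjective infinite_isSquare infinite_not_isSquare, fun n => ?_,
    fun n hn => (interleave_mem_iff (infinite_not_dvd hM2) hinf n).1 hn⟩
  have h := interleave_le (T := IsSquare) (p := (¬ M ∣ ·)) (C := M)
    (fun k => (nth_not_dvd_le hM2 k).trans (by
      have := Nat.mul_le_mul_right k hM2
      omega))
    (fun k => by simp [nth_dvd hM]) n
  rw [mul_add, mul_one]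
  omega

/-- Lower bound for set-based density under `M`-bounded displacement enumerations:
no set-based generator achieves upper density greater than `1/M`. -/
theorem bounded_adversary_set_density_lower_bound (M : ℕ) (hM : 0 < M) :
    ∃ L₁ L₂ : Set ℕ, L₁.Infinite ∧ L₂.Infinite ∧ L₁ ⊆ L₂ ∧
      upDensity L₁ L₂ = 1 / (M : ℝ) ∧
      ∃ x : ℕ → ℕ, Function.Injective x ∧ Set.range x = L₂ ∧
        MBounded x L₁ (M : ℝ) ∧ MBounded x L₂ (M : ℝ) ∧
        (∀ n : ℕ, noiseRate L₂ x n = 0) ∧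
        Filter.Tendsto (noiseRate L₁ x) Filter.atTop (nhds 0) ∧
        ∀ G : List ℕ → Set ℕ,
          (∃ nstar : ℕ, ∀ n ≥ nstar, G (prefixList x n) ⊆ L₁ \ seen x n) →
          Filter.limsup (fun n => lowDensity (G (prefixList x n)) L₂) Filter.atTop
            ≤ 1 / (M : ℝ) := by
  obtain ⟨x, hinj, hsurj, hbd, hsq⟩ := exists_bounded_permutation hM
  have hlim := tendsto_densityRatio_multiples hM
  refine ⟨{y | M ∣ y}, univ, ?_, Set.infinite_univ, Set.subset_univ _, hlim.limsup_eq, x, hinj,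
    hsurj.range_eq, mBounded_of_lt hbd _, mBounded_of_lt hbd _, fun n => by simp [noiseRate],
    tendsto_noiseRate_of_isSquare hsq, ?_⟩
  · exact Set.infinite_of_injective_forall_mem (f := fun k => M * k)
      (fun a b h => Nat.eq_of_mul_eq_mul_left hM h) (fun k => Dvd.intro k rfl)
  · rintro G ⟨N, hN⟩
    calc _ ≤ lowDensity {y | M ∣ y} univ := limsup_lowDensity_le
          (eventually_atTop.2 ⟨N, fun n hn => (hN n hn).trans Set.sdiff_subset⟩)
      _ = _ := hlim.liminf_eq
end

section
/- Let P : ℕ → ℕ → ℕ ∪ {∞} assign to each index i and step n a priority P i n, and assume i ≤ P i n and P i n ≤ P i (n+1) for all i, n. Define P_i^∞ := sup_n P i n and, for a fixed p ∈ ℕ, S(p) := {i : P_i^∞ ≤ p}. Then there exists n* such that for all n ≥ n*: (a) P i n ≤ p for every i ∈ S(p); (b) P i n > p for every i ∉ S(p); and (c) P i (n+1) = P i n for every i ∈ S(p). -/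
open Filter Set

/-- A non-decreasing sequence in `ℕ∞` whose supremum is finite is eventually equal to it. -/
theorem ENat.eventually_eq_iSup {f : ℕ → ℕ∞} (hf : Monotone f) (h : ⨆ m, f m < ⊤) :
    ∀ᶠ n in atTop, f n = ⨆ m, f m := by
  obtain ⟨N, hN⟩ := ENat.exists_eq_iSup_of_lt_top h
  filter_upwards [eventually_ge_atTop N] with n hn
  exact le_antisymm (le_iSup f n) (hN ▸ hf hn)

/-- Prefix priority stabilization: for non-decreasing priorities `P i n ∈ ℕ∞` with
`i ≤ P i n`, the set of indices with limiting priority `≤ p` eventually stabilizes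
below `p`, every other index eventually has priority `> p`, and the priorities of
the former no longer change. -/
theorem prefix_priority_stabilization (P : ℕ → ℕ → ℕ∞)
    (hlb : ∀ (i : ℕ) (n : ℕ), (i : ℕ∞) ≤ P i n)
    (hmono : ∀ (i : ℕ) (n : ℕ), P i n ≤ P i (n + 1)) (p : ℕ) :
    ∃ nstar : ℕ, ∀ n ≥ nstar,
      (∀ i : ℕ, (⨆ m, P i m) ≤ (p : ℕ∞) → P i n ≤ (p : ℕ∞)) ∧
      (∀ i : ℕ, ¬ (⨆ m, P i m) ≤ (p : ℕ∞) → (p : ℕ∞) < P i n) ∧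
      (∀ i : ℕ, (⨆ m, P i m) ≤ (p : ℕ∞) → P i (n + 1) = P i n) := by
  have hP (i : ℕ) : Monotone (P i) := monotone_nat_of_le_succ (hmono i)
  have eventually_stable (i : ℕ) : ∀ᶠ n in atTop,
      (¬ (⨆ m, P i m) ≤ (p : ℕ∞) → (p : ℕ∞) < P i n) ∧
      ((⨆ m, P i m) ≤ (p : ℕ∞) → P i n = ⨆ m, P i m) := by
    by_cases h : (⨆ m, P i m) ≤ (p : ℕ∞)
    · filter_upwards [ENat.eventually_eq_iSup (hP i) (h.trans_lt (ENat.natCast_lt_top p))] with n hn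
      exact ⟨fun h' => absurd h h', fun _ => hn⟩
    · obtain ⟨N, hN⟩ := lt_iSup_iff.1 (not_le.1 h)
      filter_upwards [eventually_ge_atTop N] with n hn
      exact ⟨fun _ => hN.trans_le (hP i hn), fun h' => absurd h' h⟩
  obtain ⟨nstar, hstar⟩ := eventually_atTop.1
    ((finite_Iic p).eventually_all.2 fun i _ => eventually_stable i)
  refine ⟨nstar, fun n hn => ⟨fun i hi => (le_iSup (P i) n).trans hi, fun i hi => ?_,
    fun i hi => ?_⟩⟩
  · rcases le_or_gt i p with hip | hip
    · exact (hstar n hn i hip).1 hi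
    · exact (Nat.cast_lt.2 hip).trans_le (hlb i n)
  · have hip : i ≤ p := Nat.cast_le.1 ((hlb i 0).trans ((le_iSup (P i) 0).trans hi))
    rw [(hstar n hn i hip).2 hi, (hstar (n + 1) (hn.trans n.le_succ) i hip).2 hi]
end

section
/- For every integer k ≥ 2 and every real c ≥ 1/k, there exist infinite languages L_1, …, L_k ⊆ ℕ and a single injective sequence x : ℕ → ℕ such that for each i ∈ {1,…,k}: L_i ⊆ range(x) and limsup_{n→∞} R(L_i; x_{1:n}) ≤ c (so x is a noisy enumeration of each L_i without omissions whose asymptotic noise rate is at most c), and yet for every function G : List ℕ → ℕ there exists some i ∈ {1,…,k} for which it is NOT the case that eventually G(x_1,…,x_n) ∈ L_i \ {x_1,…,x_n}. Hence, for c ≥ 1/k, not every collection of k languages is generable in the limit under asymptotic noise rate at most c. -/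
open Filter Set Topology

/-- At most `n / k + 1` natural numbers below `n` lie in a given residue class modulo `k`. -/
lemma ncard_lt_mod_eq_le (k r n : ℕ) :
    {t | t < n ∧ t % k = r}.ncard ≤ n / k + 1 := by
  have h : {t | t < n ∧ t % k = r}.ncard ≤ (Set.Iio (n / k + 1)).ncard := by
    refine Set.ncard_le_ncard_of_injOn (· / k) ?_ ?_ (Set.finite_Iio _)
    · rintro t ⟨ht, -⟩
      exact Nat.lt_succ_of_le (Nat.div_le_div_right ht.le)
    · rintro s ⟨-, hs⟩ t ⟨-, ht⟩ hst
      have hst : s / k = t / k := hst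
      rw [← Nat.div_add_mod s k, ← Nat.div_add_mod t k, hs, ht, hst]
  rwa [← Finset.coe_Iio, Set.ncard_coe_finset, Nat.card_Iio] at h

/-- The complement of a residue class modulo `k ≥ 2` is infinite. -/
lemma infinite_setOf_mod_ne {k : ℕ} (hk : 2 ≤ k) (r : ℕ) : {n : ℕ | n % k ≠ r}.Infinite := by
  refine Set.infinite_of_not_bddAbove ?_
  rintro ⟨B, hB⟩
  have h₀ : k * (B + 1) % k = r := by
    by_contra h
    have := hB h
    nlinarith
  have h₁ : (1 + k * (B + 1)) % k = r := by
    by_contra h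
    have := hB h
    nlinarith
  rw [Nat.mul_mod_right] at h₀
  rw [Nat.add_mul_mod_self_left, Nat.mod_eq_of_lt hk] at h₁
  omega

lemma noiseRate_setOf_mod_ne_le (k r n : ℕ) :
    noiseRate {m | m % k ≠ r} id n ≤ 1 / (k : ℝ) + 1 / (n : ℝ) := by
  rcases Nat.eq_zero_or_pos n with rfl | hn
  · simp [noiseRate]
  have hn' : (0 : ℝ) < n := by exact_mod_cast hn
  have hcard : (({t | t < n ∧ id t ∉ {m | m % k ≠ r}}.ncard : ℕ) : ℝ) ≤ n / k + 1 := by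
    have h := ncard_lt_mod_eq_le k r n
    simp only [id, Set.mem_ofPred_eq, not_not]
    calc (({t | t < n ∧ t % k = r}.ncard : ℕ) : ℝ) ≤ ((n / k + 1 : ℕ) : ℝ) := by exact_mod_cast h
      _ ≤ n / k + 1 := by
        push_cast
        gcongr
        exact Nat.cast_div_le
  calc noiseRate {m | m % k ≠ r} id n ≤ ((n : ℝ) / k + 1) / n := by
        unfold noiseRate
        gcongr
    _ = 1 / (k : ℝ) + 1 / (n : ℝ) := by
        rw [add_div, div_right_comm, div_self hn'.ne']

lemma limsup_noiseRate_setOf_mod_ne_le (k r : ℕ) :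
    limsup (noiseRate {m | m % k ≠ r} id) atTop ≤ 1 / (k : ℝ) := by
  have hlim : Tendsto (fun n : ℕ => 1 / (k : ℝ) + 1 / (n : ℝ)) atTop (𝓝 (1 / (k : ℝ))) := by
    simpa using tendsto_const_nhds.add (tendsto_one_div_atTop_nhds_zero_nat (𝕜 := ℝ))
  rw [← hlim.limsup_eq]
  refine limsup_le_limsup (Eventually.of_forall (noiseRate_setOf_mod_ne_le k r)) ?_
    hlim.isBoundedUnder_le
  refine IsBoundedUnder.isCoboundedUnder_le ⟨0, ?_⟩
  refine eventually_map.2 (Eventually.of_forall fun n => ?_)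
  unfold noiseRate
  positivity

/-- For `c ≥ 1/k` there is a collection of `k` languages that is not generable in the limit
under asymptotic noise rate at most `c`. -/
theorem finite_collection_not_generable_at_noise (k : ℕ) (hk : 2 ≤ k)
    (c : ℝ) (hc : 1 / (k : ℝ) ≤ c) :
    ∃ L : Fin k → Set ℕ, (∀ i, (L i).Infinite) ∧
      ∃ x : ℕ → ℕ, Function.Injective x ∧
        (∀ i, L i ⊆ Set.range x ∧
          Filter.limsup (noiseRate (L i) x) Filter.atTop ≤ c) ∧
        ∀ G : List ℕ → ℕ, ∃ i, ¬ ∃ N : ℕ, ∀ n ≥ N, G (prefixList x n) ∈ L i \ seen x n := by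
  refine ⟨fun i => {n | n % k ≠ i}, fun i => infinite_setOf_mod_ne hk i, id,
    Function.injective_id, fun i => ⟨by simp, (limsup_noiseRate_setOf_mod_ne_le k i).trans hc⟩,
    fun G => ?_⟩
  by_contra! h
  choose N hN using h
  let n := Finset.univ.sup N
  let i : Fin k := ⟨G (prefixList id n) % k, Nat.mod_lt _ (by omega)⟩
  exact (hN i n (Finset.le_sup (Finset.mem_univ i))).1 rfl
end

section
/- Let k ≥ 1 be an integer and let L_1, …, L_k be infinite subsets of ℕ. There exists an element-based generator G : List ℕ → ℕ (not depending on the noise level) such that for every i ∈ {1,…,k} and every injective sequence x : ℕ → ℕ with L_i ⊆ range(x) (every element of L_i appears) and limsup_{n→∞} R(L_i; x_{1:n}) < 1/k, there exists N such that for all n ≥ N, G(x_1,…,x_n) ∈ L_i \ {x_1,…,x_n}. In other words, every collection of k languages is generable in the limit against adversaries whose asymptotic noise rate is strictly below 1/k. -/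
open Filter Set Topology

open scoped Classical in
/-- The number of distinct entries of the list `l` that lie outside `A`. -/
noncomputable def noiseCount (A : Set ℕ) (l : List ℕ) : ℕ :=
  (l.toFinset.filter (· ∉ A)).card

open scoped Classical in
theorem noiseCount_prefixList (A : Set ℕ) {x : ℕ → ℕ} (hx : Function.Injective x) (n : ℕ) :
    noiseCount A (prefixList x n) = ({t | t < n ∧ x t ∉ A}).ncard := by
  have hset : {t | t < n ∧ x t ∉ A} = ↑((Finset.range n).filter (x · ∉ A)) := by
    ext t; simp
  have himage : (prefixList x n).toFinset.filter (· ∉ A)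
      = ((Finset.range n).filter (x · ∉ A)).image x := by
    ext a; simp only [prefixList, Finset.mem_filter, List.mem_toFinset, List.mem_map,
      List.mem_range, Finset.mem_image, Finset.mem_range]
    constructor
    · rintro ⟨⟨t, ht, rfl⟩, ha⟩; exact ⟨t, ⟨ht, ha⟩, rfl⟩
    · rintro ⟨t, ⟨ht, ha⟩, rfl⟩; exact ⟨⟨t, ht, rfl⟩, ha⟩
  rw [noiseCount, himage, Finset.card_image_of_injective _ hx, hset, Set.ncard_coe_finset]

theorem card_toFinset_prefixList {x : ℕ → ℕ} (hx : Function.Injective x) (n : ℕ) :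
    (prefixList x n).toFinset.card = n := by
  rw [prefixList, List.toFinset_card_of_nodup (List.nodup_range.map hx)]
  simp

/-- A union bound: if `⋂ j ∈ S, L j` is finite, then all but at most its cardinality many of the
entries of `l` are noise for some `L j` with `j ∈ S`. -/
theorem card_toFinset_le_sum_noiseCount_add_ncard {ι : Type*} (L : ι → Set ℕ) (S : Finset ι)
    (l : List ℕ) (hfin : (⋂ j ∈ S, L j).Finite) :
    l.toFinset.card ≤ ∑ j ∈ S, noiseCount (L j) l + (⋂ j ∈ S, L j).ncard := by
  classical
  have hsub : l.toFinset ⊆ S.biUnion (fun j => l.toFinset.filter (· ∉ L j)) ∪ hfin.toFinset := by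
    intro a ha
    by_cases h : ∀ j ∈ S, a ∈ L j
    · exact Finset.mem_union_right _ (hfin.mem_toFinset.2 (Set.mem_iInter₂.2 h))
    · push Not at h
      obtain ⟨j, hj, haj⟩ := h
      exact Finset.mem_union_left _
        (Finset.mem_biUnion.2 ⟨j, hj, Finset.mem_filter.2 ⟨ha, haj⟩⟩)
  calc l.toFinset.card ≤ _ := Finset.card_le_card hsub
    _ ≤ _ := Finset.card_union_le _ _
    _ ≤ _ := by
      rw [Set.ncard_eq_toFinset_card _ hfin]
      refine Nat.add_le_add_right (Finset.card_biUnion_le.trans (Finset.sum_le_sum ?_)) _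
      intro j _
      exact le_of_eq (by unfold noiseCount; congr)

theorem noiseRate_le_one (A : Set ℕ) (x : ℕ → ℕ) (n : ℕ) : noiseRate A x n ≤ 1 := by
  refine div_le_one_of_le₀ ?_ (Nat.cast_nonneg n)
  have h : ({t | t < n ∧ x t ∉ A}).ncard ≤ ({t | t < n} : Set ℕ).ncard :=
    Set.ncard_le_ncard (fun t ht => ht.1) (Set.finite_lt_nat n)
  have hn : ({t | t < n} : Set ℕ).ncard = n := by
    rw [show {t | t < n} = (↑(Finset.range n) : Set ℕ) by ext; simp, Set.ncard_coe_finset,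
      Finset.card_range]
  exact_mod_cast hn ▸ h

/-- Asymptotic noise rate below `1 / k` leaves a linear, hence eventually any constant, slack. -/
theorem eventually_mul_ncard_add_le {k : ℕ} (hk : 1 ≤ k) (A : Set ℕ) (x : ℕ → ℕ)
    (h : Filter.limsup (noiseRate A x) Filter.atTop < 1 / (k : ℝ)) (C : ℕ) :
    ∀ᶠ n in atTop, k * (({t | t < n ∧ x t ∉ A}).ncard + C) ≤ n := by
  obtain ⟨c, hc, hck⟩ := exists_between h
  have hk0 : (0 : ℝ) < k := by exact_mod_cast hk
  have hslack : 0 < 1 - k * c := by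
    rw [lt_div_iff₀ hk0] at hck; linarith
  have hbdd : IsBoundedUnder (· ≤ ·) atTop (noiseRate A x) :=
    isBoundedUnder_of ⟨1, noiseRate_le_one A x⟩
  filter_upwards [eventually_lt_of_limsup_lt hc hbdd, eventually_gt_atTop 0,
    tendsto_natCast_atTop_atTop.eventually_ge_atTop ((k * C : ℝ) / (1 - k * c))] with n hn hn0 hnC
  rw [noiseRate, div_lt_iff₀ (by exact_mod_cast hn0)] at hn
  rw [div_le_iff₀ hslack] at hnC
  have := mul_le_mul_of_nonneg_left hn.le hk0.le
  have goal : (k : ℝ) * (({t | t < n ∧ x t ∉ A}).ncard + C) ≤ n := by linarith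
  exact_mod_cast goal

/-- Every collection of `k` languages is generable in the limit against adversaries whose
asymptotic noise rate is strictly below `1/k`. -/
theorem finite_collection_generable_below_noise (k : ℕ) (hk : 1 ≤ k)
    (L : Fin k → Set ℕ) (hinf : ∀ i, (L i).Infinite) :
    ∃ G : List ℕ → ℕ, ∀ i : Fin k, ∀ x : ℕ → ℕ,
      Function.Injective x →
      L i ⊆ Set.range x →
      Filter.limsup (noiseRate (L i) x) Filter.atTop < 1 / (k : ℝ) →
      ∃ N : ℕ, ∀ n ≥ N, G (prefixList x n) ∈ L i \ seen x n := by
  classical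
  let M : ℕ := ∑ S : Finset (Fin k), (⋂ j ∈ S, L j).ncard
  let cand (l : List ℕ) : Finset (Fin k) :=
    Finset.univ.filter fun j => k * (noiseCount (L j) l + (M + 1)) ≤ l.toFinset.card
  refine ⟨fun l => sInf ((⋂ j ∈ cand l, L j) \ ↑l.toFinset), fun i x hx _ hlim => ?_⟩
  obtain ⟨N, hN⟩ := eventually_atTop.1 (eventually_mul_ncard_add_le hk (L i) x hlim (M + 1))
  refine ⟨N, fun n hn => ?_⟩
  set l := prefixList x n with hl
  have hcard : l.toFinset.card = n := card_toFinset_prefixList hx n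
  have hi : i ∈ cand l := by
    simp only [cand, Finset.mem_filter_univ, hcard]
    rw [hl, noiseCount_prefixList _ hx]
    exact hN n hn
  have hinter : (⋂ j ∈ cand l, L j).Infinite := by
    intro hfin
    have hunion := card_toFinset_le_sum_noiseCount_add_ncard L (cand l) l hfin
    have hM : (⋂ j ∈ cand l, L j).ncard ≤ M :=
      Finset.single_le_sum (f := fun S : Finset (Fin k) => (⋂ j ∈ S, L j).ncard)
        (fun _ _ => Nat.zero_le _) (Finset.mem_univ (cand l))
    have hsum : k * ∑ j ∈ cand l, (noiseCount (L j) l + (M + 1)) ≤ k * n := by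
      rw [Finset.mul_sum]
      calc _ ≤ (cand l).card • n := Finset.sum_le_card_nsmul _ _ _ fun j hj => by
              rw [← hcard]; exact (Finset.mem_filter.1 hj).2
        _ ≤ k * n := Nat.mul_le_mul_right _ (by simpa using Finset.card_le_univ (cand l))
    have hsum' := Nat.le_of_mul_le_mul_left hsum hk
    rw [Finset.sum_add_distrib, Finset.sum_const, smul_eq_mul] at hsum'
    have hpos : 1 * (M + 1) ≤ (cand l).card * (M + 1) :=
      Nat.mul_le_mul_right _ (Finset.card_pos.2 ⟨i, hi⟩)
    omega
  obtain ⟨hmem, hnew⟩ := Nat.sInf_mem (hinter.sdiff l.toFinset.finite_toSet).nonempty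
  refine ⟨Set.mem_iInter₂.1 hmem i hi, fun hseen => hnew ?_⟩
  simpa [hl, prefixList, seen] using hseen
end
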